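/- arXiv:2103.11521 — 3 statements merged into one kernel-verified Lean document; each statement's English description precedes it below -/
import Mathlib

section
/- Let MWD, RWD, RWD3, CWD be the marginal, restricted, three-variable restricted, and conditional squared Wasserstein distances associated with a probability measure Q_x on X = ℝⁿ and two Markov kernels κ, κ̂ from X to Y = ℝᵐ. Then CWD ≥ RWD ≥ MWD. -/
open MeasureTheory ProbabilityTheory
open scoped ENNReal

noncomputable section

abbrev Vec (k : ℕ) := EuclideanSpace ℝ (Fin k)

/-- A coupling of `μ` and `ν`: a probability measure on the product whose pushforwards under the
two projections are `μ` and `ν`. -/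
def IsCoupling {E : Type*} [MeasurableSpace E] (μ ν : Measure E) (π : Measure (E × E)) : Prop :=
  IsProbabilityMeasure π ∧ π.map Prod.fst = μ ∧ π.map Prod.snd = ν

/-- Squared Wasserstein-type cost with ground cost `c`, valued in `[0,∞]`. -/
def WassersteinSq {E : Type*} [MeasurableSpace E] (c : E → E → ℝ≥0∞) (μ ν : Measure E) : ℝ≥0∞ :=
  ⨅ π ∈ {π : Measure (E × E) | IsCoupling μ ν π}, ∫⁻ p, c p.1 p.2 ∂π

/-- Squared norm-distance cost `‖u - v‖²`. -/
def sqDist {E : Type*} [NormedAddCommGroup E] (u v : E) : ℝ≥0∞ := (‖u - v‖₊ : ℝ≥0∞) ^ 2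

/-- The joint law `Q_{y,x} = ∫ (κ x) ⊗ δ_x dQx` on `Y × X`. -/
def jointYX {nn mm : ℕ} (Qx : Measure (Vec nn)) (κ : Kernel (Vec nn) (Vec mm)) :
    Measure (Vec mm × Vec nn) :=
  Qx.bind fun x => (κ x).prod (Measure.dirac x)

/-- Marginal squared Wasserstein distance between `Q_y` and `Q_ŷ`. -/
def MWD {nn mm : ℕ} (Qx : Measure (Vec nn)) (κ κ' : Kernel (Vec nn) (Vec mm)) : ℝ≥0∞ :=
  WassersteinSq sqDist ((jointYX Qx κ).map Prod.fst) ((jointYX Qx κ').map Prod.fst)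

/-- Restricted squared Wasserstein distance between `Q_{y,x}` and `Q_{ŷ,x}`, where `Y × X`
carries the norm with `‖(y,x)‖² = ‖y‖² + ‖x‖²`. -/
def RWD {nn mm : ℕ} (Qx : Measure (Vec nn)) (κ κ' : Kernel (Vec nn) (Vec mm)) : ℝ≥0∞ :=
  WassersteinSq (fun p q => sqDist p.1 q.1 + sqDist p.2 q.2) (jointYX Qx κ) (jointYX Qx κ')

/-- Three-variable restricted squared Wasserstein distance. -/
def RWD3 {nn mm : ℕ} (Qx : Measure (Vec nn)) (κ κ' : Kernel (Vec nn) (Vec mm)) : ℝ≥0∞ :=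
  ⨅ ρ ∈ {ρ : Measure (Vec mm × Vec mm × Vec nn) | IsProbabilityMeasure ρ ∧
      ρ.map (fun p => (p.1, p.2.2)) = jointYX Qx κ ∧
      ρ.map (fun p => (p.2.1, p.2.2)) = jointYX Qx κ'},
    ∫⁻ p, sqDist p.1 p.2.1 ∂ρ

/-- Conditional squared Wasserstein distance. -/
def CWD {nn mm : ℕ} (Qx : Measure (Vec nn)) (κ κ' : Kernel (Vec nn) (Vec mm)) : ℝ≥0∞ :=
  ∫⁻ x, WassersteinSq sqDist (κ x) (κ' x) ∂Qx

open Filter Topology BoundedContinuousFunction CompactlySupported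

section Riesz

variable {E : Type*} [NormedAddCommGroup E] [ProperSpace E]

/-- A compactly supported tent function; these increase to `1` as `n → ∞`. -/
def tent (n : ℕ) : C_c(E, ℝ) where
  toFun w := max 0 (1 - ‖w‖ / (n + 1))
  continuous_toFun := by fun_prop
  hasCompactSupport' := by
    refine HasCompactSupport.intro (isCompact_closedBall (0 : E) (n + 1)) fun w hw => ?_
    have hw' : (n : ℝ) + 1 < ‖w‖ := by simpa using hw
    have : 1 ≤ ‖w‖ / ((n : ℝ) + 1) := by rw [le_div_iff₀ (by positivity)]; linarith
    exact max_eq_left (by linarith)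

lemma tent_apply (n : ℕ) (w : E) : tent n w = max 0 (1 - ‖w‖ / (n + 1)) := rfl

/-- The tent function as a bounded continuous function. -/
def tentBCF (n : ℕ) : E →ᵇ ℝ := (tent n).toBoundedContinuousFunction

lemma tentBCF_apply (n : ℕ) (w : E) : tentBCF n w = tent n w := rfl

lemma tent_nonneg (n : ℕ) (w : E) : 0 ≤ tent n w := le_max_left _ _

lemma tent_le_one (n : ℕ) (w : E) : tent n w ≤ 1 :=
  max_le zero_le_one (by have : 0 ≤ ‖w‖ / ((n : ℝ) + 1) := by positivity
                         linarith)

lemma tendsto_tent (w : E) : Tendsto (fun n => tent n w) atTop (𝓝 1) := by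
  have h : Tendsto (fun n : ℕ => ‖w‖ * (1 / ((n : ℝ) + 1))) atTop (𝓝 (‖w‖ * 0)) :=
    tendsto_one_div_add_atTop_nhds_zero_nat.const_mul _
  have h' := (tendsto_const_nhds (x := (0 : ℝ))).max ((tendsto_const_nhds (x := (1 : ℝ))).sub h)
  simpa [tent_apply, div_eq_mul_inv] using h'

lemma one_sub_tent_prod_le {F : Type*} [NormedAddCommGroup F] [ProperSpace F] (n : ℕ)
    (p : E × F) : 1 - tent n p ≤ (1 - tent n p.1) + (1 - tent n p.2) := by
  have h1 := tent_le_one n p.1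
  have h2 := tent_le_one n p.2
  simp only [tent_apply, Prod.norm_def] at *
  rcases le_total ‖p.1‖ ‖p.2‖ with h | h
  · rw [max_eq_right h]; linarith
  · rw [max_eq_left h]; linarith

variable [MeasurableSpace E] [BorelSpace E]

lemma tendsto_integral_mul_tent (μ : Measure E) [IsFiniteMeasure μ] (f : E →ᵇ ℝ) :
    Tendsto (fun n => ∫ w, f w * tent n w ∂μ) atTop (𝓝 (∫ w, f w ∂μ)) := by
  refine tendsto_integral_of_dominated_convergence (fun _ => ‖f‖) (fun n => ?_)
    (integrable_const _) (fun n => ae_of_all _ fun w => ?_) (ae_of_all _ fun w => ?_)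
  · exact (f.continuous.mul (tent n).continuous).aestronglyMeasurable
  · rw [norm_mul, Real.norm_of_nonneg (tent_nonneg n w)]
    exact (mul_le_of_le_one_right (norm_nonneg _) (tent_le_one n w)).trans (f.norm_coe_le_norm w)
  · simpa using (tendsto_tent w).const_mul (f w)

/-- Riesz representation of tight positive functionals on bounded continuous functions. -/
theorem exists_measure_forall_integral_eq (L : (E →ᵇ ℝ) →ₗ[ℝ] ℝ) (hL : ∀ f, 0 ≤ f → 0 ≤ L f)
    (hT : Tendsto (fun n => L (tentBCF n)) atTop (𝓝 (L 1))) :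
    ∃ μ : Measure E, IsFiniteMeasure μ ∧ ∀ f : E →ᵇ ℝ, ∫ w, f w ∂μ = L f := by
  have hmono : ∀ f g : E →ᵇ ℝ, f ≤ g → L f ≤ L g := fun f g h => by
    have := hL (g - f) (sub_nonneg.2 h)
    rw [map_sub] at this
    linarith
  let Λ₀ : C_c(E, ℝ) →ₗ[ℝ] ℝ :=
    { toFun := fun g => L g.toBoundedContinuousFunction
      map_add' := fun g h => by rw [← map_add]; rfl
      map_smul' := fun r g => by rw [RingHom.id_apply, ← map_smul]; rfl }
  let Λ : C_c(E, ℝ) →ₚ[ℝ] ℝ := PositiveLinearMap.mk₀ Λ₀ fun g hg => hL _ fun w => hg w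
  obtain ⟨μ, hμ_compacts, hμ⟩ : ∃ μ : Measure E, IsFiniteMeasureOnCompacts μ ∧
      ∀ g : C_c(E, ℝ), ∫ w, g w ∂μ = L g.toBoundedContinuousFunction :=
    ⟨RealRMK.rieszMeasure Λ, inferInstance, RealRMK.integral_rieszMeasure Λ⟩
  clear Λ Λ₀
  have hfin : IsFiniteMeasure μ := by
    refine ⟨lt_of_le_of_lt ?_ (ENNReal.ofReal_lt_top (r := L 1))⟩
    have hn : ∀ n, ∫⁻ w, ENNReal.ofReal (tent n w) ∂μ ≤ ENNReal.ofReal (L 1) := fun n => by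
      have hint : Integrable (tent n : E → ℝ) μ :=
        (tent n).continuous.integrable_of_hasCompactSupport (tent n).hasCompactSupport
      rw [← ofReal_integral_eq_lintegral_ofReal hint (ae_of_all _ (tent_nonneg n)), hμ]
      exact ENNReal.ofReal_le_ofReal (hmono _ _ fun w => tent_le_one n w)
    have hlim : ∀ w : E, liminf (fun n => ENNReal.ofReal (tent n w)) atTop = 1 := fun w => by
      simpa using (ENNReal.tendsto_ofReal (tendsto_tent w)).liminf_eq
    calc μ Set.univ = ∫⁻ w, liminf (fun n => ENNReal.ofReal (tent n w)) atTop ∂μ := by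
          simp [hlim]
      _ ≤ liminf (fun n => ∫⁻ w, ENNReal.ofReal (tent n w) ∂μ) atTop :=
          lintegral_liminf_le fun n => (tent n).continuous.measurable.ennreal_ofReal
      _ ≤ ENNReal.ofReal (L 1) :=
          liminf_le_of_frequently_le' (Frequently.of_forall hn)
  refine ⟨μ, hfin, fun f => ?_⟩
  refine tendsto_nhds_unique (tendsto_integral_mul_tent μ f) ?_
  have hfn : ∀ n, ∫ w, f w * tent n w ∂μ = L (f * tentBCF n) :=
    fun n => by
      let g : C_c(E, ℝ) := 
        { toFun := fun w => f w * tent n w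
          continuous_toFun := f.continuous.mul (tent n).continuous
          hasCompactSupport' := HasCompactSupport.mul_left (f := f) (tent n).hasCompactSupport }
      have hg : g.toBoundedContinuousFunction = f * tentBCF n := by
        ext w
        simp [g, tentBCF_apply]
      exact (hμ g).trans (congrArg L hg)
  simp_rw [hfn]
  have hle : ∀ (g : E →ᵇ ℝ) n, L (g * tentBCF n) - L g
      ≤ ‖g‖ * (L 1 - L (tentBCF n)) := fun g n => by
    rw [← map_sub, ← map_sub, ← smul_eq_mul ‖g‖, ← map_smul L]
    refine hmono _ _ fun w => ?_
    have h1 := tent_le_one n w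
    have h2 := (abs_le.1 (g.norm_coe_le_norm w)).1
    change g w * tent n w - g w ≤ ‖g‖ * (1 - tent n w)
    nlinarith
  have h0 : Tendsto (fun n => ‖f‖ * (L 1 - L (tentBCF n))) atTop
      (𝓝 0) := by
    simpa using ((tendsto_const_nhds (x := L 1)).sub hT).const_mul ‖f‖
  rw [tendsto_iff_dist_tendsto_zero]
  refine squeeze_zero (fun _ => dist_nonneg) (fun n => ?_) h0
  rw [Real.dist_eq, abs_le]
  have := hle (-f) n
  have hneg : -f * tentBCF n = -(f * tentBCF n) := by
    ext w
    simp
  rw [hneg, map_neg, map_neg, norm_neg] at this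
  exact ⟨by linarith, hle f n⟩

end Riesz

section Duality

variable {E : Type*} [NormedAddCommGroup E] [ProperSpace E] [MeasurableSpace E] [BorelSpace E]

/-- The function `(z, w) ↦ φ z + ψ w`. -/
def sumPair (φ ψ : E →ᵇ ℝ) : E × E →ᵇ ℝ :=
  φ.compContinuous ⟨Prod.fst, continuous_fst⟩ + ψ.compContinuous ⟨Prod.snd, continuous_snd⟩

omit [ProperSpace E] [MeasurableSpace E] [BorelSpace E] in
lemma sumPair_apply (φ ψ : E →ᵇ ℝ) (p : E × E) : sumPair φ ψ p = φ p.1 + ψ p.2 := rfl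

lemma integral_sumPair (α β : Measure E) [IsProbabilityMeasure α] [IsProbabilityMeasure β]
    (φ ψ : E →ᵇ ℝ) :
    ∫ p, sumPair φ ψ p ∂(α.prod β) = ∫ z, φ z ∂α + ∫ w, ψ w ∂β := by
  simp only [sumPair_apply]
  rw [integral_add ((φ.integrable α).comp_fst β) ((ψ.integrable β).comp_snd α),
    integral_fun_fst, integral_fun_snd]
  simp

/-- A positive functional on `C_b(E × E)` with the prescribed marginals whose value on every
bounded continuous minorant of the cost is at most the dual bound. -/
lemma exists_linearMap_le (α β : Measure E) [IsProbabilityMeasure α] [IsProbabilityMeasure β]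
    (c : E × E → ℝ) (D : ℝ)
    (hD : ∀ φ ψ : E →ᵇ ℝ, (∀ z w, φ z + ψ w ≤ c (z, w)) → ∫ z, φ z ∂α + ∫ w, ψ w ∂β ≤ D) :
    ∃ L : (E × E →ᵇ ℝ) →ₗ[ℝ] ℝ, (∀ f, 0 ≤ f → 0 ≤ L f) ∧
      (∀ φ ψ, L (sumPair φ ψ) = ∫ z, φ z ∂α + ∫ w, ψ w ∂β) ∧
      ∀ f : E × E →ᵇ ℝ, (∀ p, f p ≤ c p) → L f ≤ D := by
  let S : Submodule ℝ ((E × E →ᵇ ℝ) × ℝ) :=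
    { carrier := {h | ∃ φ ψ, h.1 = sumPair φ ψ}
      add_mem' := by
        rintro a b ⟨φ, ψ, h⟩ ⟨φ', ψ', h'⟩
        refine ⟨φ + φ', ψ + ψ', ?_⟩
        ext p
        simp only [Prod.fst_add, h, h', BoundedContinuousFunction.add_apply, sumPair_apply]
        ring
      zero_mem' := ⟨0, 0, by ext p; simp [sumPair_apply]⟩
      smul_mem' := by
        rintro r a ⟨φ, ψ, h⟩
        refine ⟨r • φ, r • ψ, ?_⟩
        ext p
        simp only [Prod.smul_fst, h, BoundedContinuousFunction.smul_apply, sumPair_apply,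
          smul_eq_mul]
        ring }
  let G : ((E × E →ᵇ ℝ) × ℝ) →ₗ[ℝ] ℝ :=
    { toFun := fun h => ∫ p, h.1 p ∂(α.prod β) + h.2 * D
      map_add' := fun a b => by
        simp only [Prod.fst_add, Prod.snd_add, BoundedContinuousFunction.add_apply]
        rw [integral_add (a.1.integrable _) (b.1.integrable _)]
        ring
      map_smul' := fun r a => by
        simp only [Prod.smul_fst, Prod.smul_snd, BoundedContinuousFunction.smul_apply,
          smul_eq_mul, RingHom.id_apply, integral_const_mul]
        ring }
  let K : PointedCone ℝ ((E × E →ᵇ ℝ) × ℝ) :=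
    { carrier := {h | 0 ≤ h.2 ∧ ∀ p, 0 ≤ h.1 p + h.2 * c p}
      add_mem' := by
        rintro a b ⟨h1, h2⟩ ⟨h1', h2'⟩
        refine ⟨add_nonneg h1 h1', fun p => ?_⟩
        have := add_nonneg (h2 p) (h2' p)
        simp only [Prod.fst_add, Prod.snd_add, BoundedContinuousFunction.add_apply]
        linarith
      zero_mem' := ⟨le_rfl, fun p => by simp⟩
      smul_mem' := by
        rintro ⟨r, hr⟩ a ⟨h1, h2⟩
        refine ⟨mul_nonneg hr h1, fun p => ?_⟩
        have := mul_nonneg hr (h2 p)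
        change 0 ≤ r * a.1 p + r * a.2 * c p
        linarith }
  obtain ⟨g, hgS, hgK⟩ := riesz_extension K ⟨S, G.comp S.subtype⟩ (by
    rintro ⟨⟨h, t⟩, φ, ψ, hh⟩ ⟨ht, hp⟩
    dsimp only at hh ht hp
    change 0 ≤ ∫ p, h p ∂(α.prod β) + t * D
    rcases ht.eq_or_lt with rfl | ht
    · simpa using integral_nonneg fun p => by simpa using hp p
    · have := hD (-(t⁻¹ • φ)) (-(t⁻¹ • ψ)) fun z w => by
        have := hp (z, w)
        rw [hh, sumPair_apply] at this
        simp only [BoundedContinuousFunction.neg_apply, BoundedContinuousFunction.smul_apply,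
          smul_eq_mul]
        rw [← mul_le_mul_iff_right₀ ht]
        field_simp
        linarith
      simp only [BoundedContinuousFunction.neg_apply, BoundedContinuousFunction.smul_apply,
        smul_eq_mul, integral_neg, integral_const_mul] at this
      rw [← mul_le_mul_iff_right₀ ht] at this
      field_simp at this
      rw [hh, integral_sumPair]
      linarith) (by
    rintro ⟨f, t⟩
    refine ⟨⟨(BoundedContinuousFunction.const _ ‖f‖, -t),
      BoundedContinuousFunction.const _ ‖f‖, 0, ?_⟩, ?_, fun p => ?_⟩
    · ext p; simp [sumPair_apply]
    · simp
    · have := (abs_le.1 (f.norm_coe_le_norm p)).1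
      simp only [Prod.mk_add_mk, neg_add_cancel, zero_mul, add_zero,
        BoundedContinuousFunction.add_apply, BoundedContinuousFunction.const_apply]
      linarith)
  have hg1 : g (0, 1) = D := by
    have := hgS ⟨(0, 1), 0, 0, by ext p; simp [sumPair_apply]⟩
    simpa [G] using this
  refine ⟨g.comp (LinearMap.inl ℝ _ _), fun f hf => hgK _ ⟨le_rfl, fun p => ?_⟩,
    fun φ ψ => ?_, fun f hf => ?_⟩
  · simpa using hf p
  · have := hgS ⟨(sumPair φ ψ, 0), φ, ψ, rfl⟩
    rw [← integral_sumPair]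
    simpa [G] using this
  · have := hgK (-f, 1) ⟨zero_le_one, fun p => by simpa using hf p⟩
    have heq : ((-f, 1) : (E × E →ᵇ ℝ) × ℝ) = (0, 1) - (f, 0) := by simp
    rw [heq, map_sub, hg1] at this
    simpa using this

/-- Kantorovich duality for a continuous nonnegative cost: a bound on the dual problem is attained
by some coupling. -/
theorem exists_isCoupling_lintegral_le (α β : Measure E) [IsProbabilityMeasure α]
    [IsProbabilityMeasure β] (c : E × E → ℝ) (hc : Continuous c) (hc0 : ∀ p, 0 ≤ c p) (D : ℝ)
    (hD : ∀ φ ψ : E →ᵇ ℝ, (∀ z w, φ z + ψ w ≤ c (z, w)) → ∫ z, φ z ∂α + ∫ w, ψ w ∂β ≤ D) :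
    ∃ π, IsCoupling α β π ∧ ∫⁻ p, ENNReal.ofReal (c p) ∂π ≤ ENNReal.ofReal D := by
  obtain ⟨L, hpos, hmarg, hcost⟩ := exists_linearMap_le α β c D hD
  have hL1 : L 1 = 1 := by
    have h : (1 : E × E →ᵇ ℝ) = sumPair 1 0 := by ext p; simp [sumPair_apply]
    rw [h, hmarg]
    simp
  have htight : Tendsto (fun n => L (tentBCF n)) atTop (𝓝 (L 1)) := by
    have h1 : ∀ γ : Measure E, [IsProbabilityMeasure γ] →
        Tendsto (fun n => ∫ w, tent n w ∂γ) atTop (𝓝 1) := fun γ _ => by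
      simpa using tendsto_integral_mul_tent γ 1
    have hlow : ∀ n, ∫ w, tent n w ∂α + ∫ w, tent n w ∂β - 1
        ≤ L (tentBCF n) := fun n => by
      have := hpos (tentBCF n - (sumPair (E := E) (tentBCF n) (tentBCF n) - 1))
        fun p : E × E => by
          have := one_sub_tent_prod_le n p
          change (0 : ℝ) ≤ (tentBCF n - (sumPair (E := E) (tentBCF n) (tentBCF n) - 1) : E × E →ᵇ ℝ) p
          simp only [BoundedContinuousFunction.sub_apply, sumPair_apply, tentBCF_apply,
            BoundedContinuousFunction.coe_one, Pi.one_apply]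
          linarith
      rw [map_sub, map_sub, hmarg, hL1] at this
      change 0 ≤ _ - (∫ w, tent n w ∂α + ∫ w, tent n w ∂β - 1) at this
      linarith
    have hup : ∀ n, L (tentBCF n) ≤ L 1 := fun n => by
      have := hpos (1 - tentBCF n) fun p => by
        change (0 : ℝ) ≤ 1 - tent n p
        linarith [tent_le_one n p]
      rw [map_sub] at this
      linarith
    refine tendsto_of_tendsto_of_tendsto_of_le_of_le ?_ tendsto_const_nhds hlow hup
    rw [hL1]
    simpa using ((h1 α).add (h1 β)).sub_const 1
  obtain ⟨π, hfin, hπ⟩ := exists_measure_forall_integral_eq L hpos htight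
  have hprob : IsProbabilityMeasure π := by
    have h := hπ 1
    rw [hL1] at h
    simp only [BoundedContinuousFunction.coe_one, Pi.one_apply, integral_const, smul_eq_mul,
      mul_one] at h
    exact ⟨(ENNReal.toReal_eq_one_iff _).1 h⟩
  refine ⟨π, ⟨hprob, ?_, ?_⟩, ?_⟩
  · refine ext_of_forall_integral_eq_of_IsFiniteMeasure fun φ => ?_
    rw [integral_map measurable_fst.aemeasurable φ.continuous.aestronglyMeasurable]
    simpa [hmarg, sumPair_apply] using hπ (sumPair φ 0)
  · refine ext_of_forall_integral_eq_of_IsFiniteMeasure fun ψ => ?_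
    rw [integral_map measurable_snd.aemeasurable ψ.continuous.aestronglyMeasurable]
    simpa [hmarg, sumPair_apply] using hπ (sumPair 0 ψ)
  · have hsup : ∀ p, ENNReal.ofReal (c p) = ⨆ n : ℕ, ENNReal.ofReal (min (c p) n) := fun p => by
      refine le_antisymm ?_ (iSup_le fun n => ENNReal.ofReal_le_ofReal (min_le_left _ _))
      obtain ⟨n, hn⟩ := exists_nat_ge (c p)
      exact le_iSup_of_le n (by rw [min_eq_left hn])
    simp_rw [hsup]
    rw [lintegral_iSup (fun n => (hc.min continuous_const).measurable.ennreal_ofReal)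
      fun m n hmn p => ENNReal.ofReal_le_ofReal (min_le_min le_rfl (Nat.cast_le.2 hmn))]
    refine iSup_le fun n => ?_
    have hnn : ∀ p, 0 ≤ min (c p) n := fun p => le_min (hc0 p) n.cast_nonneg
    let f : E × E →ᵇ ℝ := BoundedContinuousFunction.ofNormedAddCommGroup
      (fun p => min (c p) n) (hc.min continuous_const) n fun p => by
        rw [Real.norm_of_nonneg (hnn p)]
        exact min_le_right _ _
    calc ∫⁻ p, ENNReal.ofReal (f p) ∂π = ENNReal.ofReal (∫ p, f p ∂π) :=
          (ofReal_integral_eq_lintegral_ofReal (f.integrable π) (ae_of_all _ hnn)).symm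
      _ ≤ ENNReal.ofReal D :=
          ENNReal.ofReal_le_ofReal ((hπ f).trans_le (hcost f fun p => min_le_left _ _))

end Duality

section WeakDuality

lemma ofReal_integral_le_lintegral_ofReal {Ω : Type*} [MeasurableSpace Ω] {μ : Measure Ω}
    {f : Ω → ℝ} (hf : Integrable f μ) :
    ENNReal.ofReal (∫ x, f x ∂μ) ≤ ∫⁻ x, ENNReal.ofReal (f x) ∂μ := by
  rw [integral_eq_lintegral_pos_part_sub_lintegral_neg_part hf]
  refine (ENNReal.ofReal_le_ofReal (sub_le_self _ ENNReal.toReal_nonneg)).trans ?_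
  exact ENNReal.ofReal_toReal_le

lemma ofReal_integral_add_le_wassersteinSq {E : Type*} [MeasurableSpace E] (μ ν : Measure E)
    (c : E → E → ℝ≥0∞) {φ ψ : E → ℝ} (hφ : Integrable φ μ) (hψ : Integrable ψ ν)
    (h : ∀ u v, ENNReal.ofReal (φ u + ψ v) ≤ c u v) :
    ENNReal.ofReal (∫ u, φ u ∂μ + ∫ v, ψ v ∂ν) ≤ WassersteinSq c μ ν := by
  refine le_iInf₂ fun π hπ => ?_
  obtain ⟨-, rfl, rfl⟩ := hπ
  have hφ' : Integrable (fun p : E × E => φ p.1) π := hφ.comp_measurable measurable_fst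
  have hψ' : Integrable (fun p : E × E => ψ p.2) π := hψ.comp_measurable measurable_snd
  rw [integral_map measurable_fst.aemeasurable hφ.1,
    integral_map measurable_snd.aemeasurable hψ.1, ← integral_add hφ' hψ']
  exact (ofReal_integral_le_lintegral_ofReal (hφ'.add hψ')).trans
    (lintegral_mono fun p => h _ _)

end WeakDuality

lemma sqDist_eq_ofReal {E : Type*} [NormedAddCommGroup E] (u v : E) :
    sqDist u v = ENNReal.ofReal (‖u - v‖ ^ 2) := by
  rw [sqDist, ENNReal.ofReal_pow (norm_nonneg _), ofReal_norm]
  rfl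

section Kernels

variable {nn mm : ℕ} (Qx : Measure (Vec nn)) [IsProbabilityMeasure Qx]
  (κ κ' : Kernel (Vec nn) (Vec mm)) [IsMarkovKernel κ] [IsMarkovKernel κ']

lemma jointYX_eq_map_swap : jointYX Qx κ = (Qx ⊗ₘ κ).map Prod.swap := by
  rw [Measure.compProd_eq_comp_prod, Measure.map_comp _ _ measurable_swap, Kernel.map_prod_swap]
  unfold jointYX
  congr 1
  ext1 x
  rw [Kernel.prod_apply, Kernel.id_apply]

instance : IsProbabilityMeasure (jointYX Qx κ) := by
  rw [jointYX_eq_map_swap]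
  exact Measure.isProbabilityMeasure_map measurable_swap.aemeasurable

lemma integral_jointYX (φ : Vec mm × Vec nn →ᵇ ℝ) :
    ∫ z, φ z ∂(jointYX Qx κ) = ∫ x, ∫ y, φ (y, x) ∂(κ x) ∂Qx := by
  rw [jointYX_eq_map_swap,
    integral_map measurable_swap.aemeasurable φ.continuous.aestronglyMeasurable]
  exact Measure.integral_compProd
    ((φ.compContinuous ⟨Prod.swap, continuous_swap⟩).integrable _)

lemma integrable_integral_kernel (φ : Vec mm × Vec nn →ᵇ ℝ) :
    Integrable (fun x => ∫ y, φ (y, x) ∂(κ x)) Qx :=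
  Integrable.integral_compProd (κ := Kernel.const Unit Qx) (a := ())
    ((φ.compContinuous ⟨Prod.swap, continuous_swap⟩).integrable (Qx ⊗ₘ κ))

lemma ofReal_integral_jointYX_add_le_CWD (φ ψ : Vec mm × Vec nn →ᵇ ℝ)
    (h : ∀ z w, φ z + ψ w ≤ ‖z.1 - w.1‖ ^ 2 + ‖z.2 - w.2‖ ^ 2) :
    ENNReal.ofReal (∫ z, φ z ∂(jointYX Qx κ) + ∫ w, ψ w ∂(jointYX Qx κ')) ≤ CWD Qx κ κ' := by
  have hi := integrable_integral_kernel Qx κ φ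
  have hi' := integrable_integral_kernel Qx κ' ψ
  rw [integral_jointYX, integral_jointYX, ← integral_add hi hi']
  refine (ofReal_integral_le_lintegral_ofReal (hi.add hi')).trans (lintegral_mono fun x => ?_)
  have hint : ∀ (η : Kernel (Vec nn) (Vec mm)) [IsMarkovKernel η] (χ : Vec mm × Vec nn →ᵇ ℝ),
      Integrable (fun y => χ (y, x)) (η x) := fun η _ χ =>
    (χ.compContinuous ⟨fun y => (y, x), by fun_prop⟩).integrable (η x)
  refine ofReal_integral_add_le_wassersteinSq _ _ _ (hint κ φ) (hint κ' ψ) fun u v => ?_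
  rw [sqDist_eq_ofReal]
  exact ENNReal.ofReal_le_ofReal (by simpa using h (u, x) (v, x))

theorem RWD_le_CWD : RWD Qx κ κ' ≤ CWD Qx κ κ' := by
  by_cases htop : CWD Qx κ κ' = ∞
  · simp [htop]
  obtain ⟨π, hπ, hle⟩ := exists_isCoupling_lintegral_le (jointYX Qx κ) (jointYX Qx κ')
    (fun p => ‖p.1.1 - p.2.1‖ ^ 2 + ‖p.1.2 - p.2.2‖ ^ 2) (by fun_prop) (fun p => by positivity)
    (CWD Qx κ κ').toReal fun φ ψ h => (ENNReal.ofReal_le_iff_le_toReal htop).1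
      (ofReal_integral_jointYX_add_le_CWD Qx κ κ' φ ψ h)
  rw [ENNReal.ofReal_toReal htop] at hle
  refine (iInf₂_le π hπ).trans (le_trans (lintegral_mono fun p => ?_) hle)
  simp only [sqDist_eq_ofReal]
  rw [ENNReal.ofReal_add (by positivity) (by positivity)]

omit [IsProbabilityMeasure Qx] [IsMarkovKernel κ] [IsMarkovKernel κ'] in
theorem MWD_le_RWD : MWD Qx κ κ' ≤ RWD Qx κ κ' := by
  refine le_iInf₂ fun π hπ => ?_
  obtain ⟨hprob, h1, h2⟩ := hπ
  have hm : Measurable (Prod.map Prod.fst Prod.fst :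
      (Vec mm × Vec nn) × (Vec mm × Vec nn) → Vec mm × Vec mm) :=
    measurable_fst.prodMap measurable_fst
  have hcoup : IsCoupling ((jointYX Qx κ).map Prod.fst) ((jointYX Qx κ').map Prod.fst)
      (π.map (Prod.map Prod.fst Prod.fst)) := by
    refine ⟨Measure.isProbabilityMeasure_map hm.aemeasurable, ?_, ?_⟩
    · rw [← h1, Measure.map_map measurable_fst hm, Measure.map_map measurable_fst measurable_fst]
      rfl
    · rw [← h2, Measure.map_map measurable_snd hm, Measure.map_map measurable_fst measurable_snd]
      rfl
  exact (iInf₂_le _ hcoup).trans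
    ((lintegral_map_le _ _).trans (lintegral_mono fun p => le_self_add))

end Kernels

/-- CWD ≥ RWD ≥ MWD. -/
theorem cwd_ge_rwd_ge_mwd (nn mm : ℕ) (Qx : Measure (Vec nn)) [IsProbabilityMeasure Qx]
    (κ κ' : Kernel (Vec nn) (Vec mm)) [IsMarkovKernel κ] [IsMarkovKernel κ'] :
    CWD Qx κ κ' ≥ RWD Qx κ κ' ∧ RWD Qx κ κ' ≥ MWD Qx κ κ' :=
  ⟨RWD_le_CWD Qx κ κ', MWD_le_RWD Qx κ κ'⟩
end
end

section
/- With MWD, RWD, RWD3, CWD as defined from a probability measure Q_x on X = ℝⁿ and Markov kernels κ, κ̂ from X to Y = ℝᵐ, one has CWD ≥ RWD3. -/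
open MeasureTheory ProbabilityTheory
open scoped ENNReal

noncomputable section

open Filter Topology Set
open scoped NNReal BoundedContinuousFunction

/-- If every measurable set disjoint from `S` is null, then a measurable map into a countable space
admits a section defined on all of the target which takes its values in `S`. -/
lemma exists_ae_section_mem {X ι : Type*} [MeasurableSpace X] [MeasurableSpace ι] [Countable ι]
    [MeasurableSingletonClass ι] {Q : Measure X} {S : Set X} (hne : S.Nonempty)
    (hS : ∀ A, MeasurableSet A → Disjoint A S → Q A = 0) {r : X → ι} (hr : Measurable r) :
    ∃ t : ι → X, (∀ i, t i ∈ S) ∧ ∀ᵐ x ∂Q, r (t (r x)) = r x := by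
  classical
  obtain ⟨s₀, hs₀⟩ := hne
  refine ⟨fun i => if h : ∃ s ∈ S, r s = i then h.choose else s₀, fun i => ?_, ?_⟩
  · dsimp only
    split_ifs with h
    · exact h.choose_spec.1
    · exact hs₀
  · have hnull : Q (r ⁻¹' {i | ¬ ∃ s ∈ S, r s = i}) = 0 := by
      refine hS _ (hr (Set.to_countable _).measurableSet) ?_
      rw [Set.disjoint_left]
      exact fun x hx hxS => hx ⟨x, hxS, rfl⟩
    have hae : ∀ᵐ x ∂Q, ∃ s ∈ S, r s = r x := by
      rw [ae_iff]
      exact hnull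
    filter_upwards [hae] with x hx
    rw [dif_pos hx]
    exact hx.choose_spec.2

/-- A nonnegative measurable function varies by at most `δ` on each cell of a suitable countable
measurable partition. -/
lemma exists_measurable_nat_forall_le_add {X : Type*} [MeasurableSpace X] {F : X → ℝ≥0}
    (hF : Measurable F) {δ : ℝ≥0} (hδ : 0 < δ) :
    ∃ r : X → ℕ, Measurable r ∧ ∀ x y, r x = r y → F x ≤ F y + δ := by
  refine ⟨fun x => ⌊F x / δ⌋₊, Nat.measurable_floor.comp (hF.div_const δ), fun x y h => ?_⟩
  have h₁ : F x / δ < ⌊F x / δ⌋₊ + 1 := Nat.lt_floor_add_one _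
  have h₂ : (⌊F y / δ⌋₊ : ℝ≥0) ≤ F y / δ := Nat.floor_le zero_le
  dsimp only at h
  rw [h] at h₁
  have h₃ : F x / δ ≤ F y / δ + 1 := h₁.le.trans (by gcongr)
  calc F x = F x / δ * δ := by field_simp
    _ ≤ (F y / δ + 1) * δ := by gcongr
    _ = F y + δ := by field_simp

/-- If every measurable set disjoint from `S` is null, the identity is approximated along a filter
by maps with values in `S` which factor through countable spaces, in such a way that every
measurable function `F : X → ℝ≥0` is approximated uniformly almost everywhere. -/
lemma exists_countable_valued_approx {X : Type*} [MeasurableSpace X] {Q : Measure X} {S : Set X}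
    (hne : S.Nonempty) (hS : ∀ A, MeasurableSet A → Disjoint A S → Q A = 0) :
    ∃ T : Finset {r : X → ℕ // Measurable r} → X → X, (∀ J x, T J x ∈ S) ∧
      (∀ J, Measurable[_, ⊤] (T J)) ∧
      ∀ F : X → ℝ≥0, Measurable F → ∀ δ : ℝ≥0, 0 < δ →
        ∀ᶠ J in atTop, ∀ᵐ x ∂Q, F (T J x) ≤ F x + δ ∧ F x ≤ F (T J x) + δ := by
  let R (J : Finset {r : X → ℕ // Measurable r}) (x : X) : J → ℕ := fun j => j.1.1 x
  have hR (J) : Measurable (R J) := measurable_pi_lambda _ fun j => j.1.2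
  choose t ht hQ using fun J => exists_ae_section_mem hne hS (hR J)
  refine ⟨fun J x => t J (R J x), fun J x => ht J _, fun J => ?_, fun F hF δ hδ => ?_⟩
  · exact fun A _ => hR J ((t J ⁻¹' A).to_countable.measurableSet)
  · obtain ⟨r, hr, hrF⟩ := exists_measurable_nat_forall_le_add hF hδ
    filter_upwards [eventually_ge_atTop {⟨r, hr⟩}] with J hJ
    filter_upwards [hQ J] with x hx
    have hrx : r (t J (R J x)) = r x := congrFun hx ⟨⟨r, hr⟩, Finset.singleton_subset_iff.1 hJ⟩
    exact ⟨hrF _ _ hrx, hrF _ _ hrx.symm⟩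

lemma map_bind_eq_bind_map {X G E : Type*} [MeasurableSpace X] [MeasurableSpace G]
    [MeasurableSpace E] {Q : Measure X} {σ : X → Measure G} (hσ : Measurable σ) {p : G → E}
    (hp : Measurable p) : (Q.bind σ).map p = Q.bind fun x => (σ x).map p := by
  ext s hs
  rw [Measure.map_apply hp hs, Measure.bind_apply (hp hs) hσ.aemeasurable,
    Measure.bind_apply hs (f := fun x => (σ x).map p)
      ((Measure.measurable_map p hp).comp hσ).aemeasurable]
  simp_rw [Measure.map_apply hp hs]

lemma isProbabilityMeasure_bind' {X E : Type*} [MeasurableSpace X] [MeasurableSpace E]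
    {Q : Measure X} [IsProbabilityMeasure Q] {M : X → Measure E} (hM : Measurable M)
    (hM' : ∀ x, IsProbabilityMeasure (M x)) : IsProbabilityMeasure (Q.bind M) :=
  ⟨by simp [Measure.bind_apply MeasurableSet.univ hM.aemeasurable]⟩

/-- If the maps `T j` approximate the identity in the sense that bounded measurable functions are
approximated uniformly, then mixtures reparametrised by `T j` converge weakly. -/
lemma tendsto_bind_comp {X E ι : Type*} [MeasurableSpace X] [MeasurableSpace E]
    [TopologicalSpace E] [OpensMeasurableSpace E] {Q : Measure X} [IsProbabilityMeasure Q]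
    {l : Filter ι} {T : ι → X → X} {M : X → Measure E} (hM : Measurable M)
    [∀ x, IsProbabilityMeasure (M x)] (hMT : ∀ j, Measurable fun x => M (T j x))
    (hT : ∀ F : X → ℝ≥0, Measurable F → ∀ δ : ℝ≥0, 0 < δ →
        ∀ᶠ j in l, ∀ᵐ x ∂Q, F (T j x) ≤ F x + δ ∧ F x ≤ F (T j x) + δ)
    {m : ProbabilityMeasure E} (hm : (m : Measure E) = Q.bind M) {mT : ι → ProbabilityMeasure E}
    (hmT : ∀ j, (mT j : Measure E) = Q.bind fun x => M (T j x)) :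
    Tendsto mT l (𝓝 m) := by
  rw [ProbabilityMeasure.tendsto_iff_forall_lintegral_tendsto]
  intro f
  have hf : Measurable fun e => (f e : ℝ≥0∞) := f.continuous.measurable.coe_nnreal_ennreal
  have hfin (x) : ∫⁻ e, f e ∂(M x) ≠ ∞ := (f.lintegral_lt_top_of_nnreal _).ne
  let F (x : X) : ℝ≥0 := (∫⁻ e, f e ∂(M x)).toNNReal
  have hF : Measurable F := ((Measure.measurable_lintegral hf).comp hM).ennreal_toNNReal
  have hFeq (x) : ∫⁻ e, f e ∂(M x) = F x := (ENNReal.coe_toNNReal (hfin x)).symm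
  have hlim : ∫⁻ e, f e ∂(m : Measure E) = ∫⁻ x, F x ∂Q := by
    rw [hm, Measure.lintegral_bind hM.aemeasurable hf.aemeasurable]
    exact lintegral_congr hFeq
  have happrox (j) : ∫⁻ e, f e ∂(mT j : Measure E) = ∫⁻ x, F (T j x) ∂Q := by
    rw [hmT, Measure.lintegral_bind (hMT j).aemeasurable hf.aemeasurable]
    exact lintegral_congr fun x => hFeq (T j x)
  simp_rw [happrox, hlim]
  have hint : ∫⁻ x, F x ∂Q ≠ ∞ := hlim ▸ (f.lintegral_lt_top_of_nnreal (m : Measure E)).ne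
  rw [ENNReal.tendsto_nhds hint]
  intro ε hε
  obtain ⟨δ, hδ, hδε⟩ := ENNReal.lt_iff_exists_nnreal_btwn.1 hε
  filter_upwards [hT F hF δ (by exact_mod_cast hδ)] with j hj
  have add_const (g : X → ℝ≥0) : ∫⁻ x, ((g x + δ : ℝ≥0) : ℝ≥0∞) ∂Q ≤ ∫⁻ x, g x ∂Q + ε := by
    simp only [ENNReal.coe_add]
    rw [lintegral_add_right _ measurable_const]
    simpa using add_le_add_right hδε.le _
  constructor
  · rw [tsub_le_iff_right]
    refine (lintegral_mono_ae ?_).trans (add_const _)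
    filter_upwards [hj] with x hx
    exact_mod_cast hx.2
  · refine (lintegral_mono_ae ?_).trans (add_const _)
    filter_upwards [hj] with x hx
    exact_mod_cast hx.1

/-- Measures `σ x` with prescribed marginals and controlled cost, chosen without any measurability
for `x` in a set of full outer measure, give approximate joint measures for the mixtures. -/
lemma mem_closure_marginals_of_forall_mem {X E G : Type*} [MeasurableSpace X] [MeasurableSpace E]
    [TopologicalSpace E] [BorelSpace E] [MeasurableSpace G] {Q : Measure X}
    [IsProbabilityMeasure Q] {S : Set X} (hne : S.Nonempty)
    (hS : ∀ A, MeasurableSet A → Disjoint A S → Q A = 0) {p₁ p₂ : G → E} (hp₁ : Measurable p₁)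
    (hp₂ : Measurable p₂) {M₁ M₂ : X → Measure E} (hM₁ : Measurable M₁) (hM₂ : Measurable M₂)
    [∀ x, IsProbabilityMeasure (M₁ x)] [∀ x, IsProbabilityMeasure (M₂ x)] {c : G → ℝ≥0}
    (hc : Measurable c) {g : X → ℝ≥0} (hg : Measurable g) {σ : X → Measure G}
    (hσ : ∀ x ∈ S, IsProbabilityMeasure (σ x) ∧ (σ x).map p₁ = M₁ x ∧ (σ x).map p₂ = M₂ x ∧
      ∫⁻ y, c y ∂(σ x) ≤ g x)
    {m₁ m₂ : ProbabilityMeasure E} (hm₁ : (m₁ : Measure E) = Q.bind M₁)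
    (hm₂ : (m₂ : Measure E) = Q.bind M₂) {δ : ℝ≥0} (hδ : 0 < δ) :
    (m₁, m₂) ∈ closure ((fun ρ : ProbabilityMeasure G =>
      (ρ.map hp₁.aemeasurable, ρ.map hp₂.aemeasurable)) ''
        {ρ | ∫⁻ y, c y ∂(ρ : Measure G) ≤ ∫⁻ x, g x ∂Q + δ}) := by
  obtain ⟨T, hTS, hTm, hT⟩ := exists_countable_valued_approx hne hS
  have hσT (J) : Measurable fun x => σ (T J x) := measurable_from_top.comp (hTm J)
  let ρ (J) : ProbabilityMeasure G :=
    ⟨Q.bind fun x => σ (T J x), isProbabilityMeasure_bind' (hσT J) fun x => (hσ _ (hTS J x)).1⟩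
  have h₁ : Tendsto (fun J => (ρ J).map hp₁.aemeasurable) atTop (𝓝 m₁) := by
    refine tendsto_bind_comp hM₁ (fun j => measurable_from_top.comp (hTm j)) hT hm₁ fun j => ?_
    rw [ProbabilityMeasure.toMeasure_map]
    exact (map_bind_eq_bind_map (hσT j) hp₁).trans
      (congrArg Q.bind (funext fun x => (hσ _ (hTS j x)).2.1))
  have h₂ : Tendsto (fun J => (ρ J).map hp₂.aemeasurable) atTop (𝓝 m₂) := by
    refine tendsto_bind_comp hM₂ (fun j => measurable_from_top.comp (hTm j)) hT hm₂ fun j => ?_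
    rw [ProbabilityMeasure.toMeasure_map]
    exact (map_bind_eq_bind_map (hσT j) hp₂).trans
      (congrArg Q.bind (funext fun x => (hσ _ (hTS j x)).2.2.1))
  refine mem_closure_of_tendsto (h₁.prodMk_nhds h₂) ?_
  filter_upwards [hT g hg δ hδ] with J hJ
  refine ⟨ρ J, ?_, rfl⟩
  calc ∫⁻ y, c y ∂(Q.bind fun x => σ (T J x))
      = ∫⁻ x, ∫⁻ y, c y ∂(σ (T J x)) ∂Q :=
        Measure.lintegral_bind (hσT J).aemeasurable hc.coe_nnreal_ennreal.aemeasurable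
    _ ≤ ∫⁻ x, ((g x + δ : ℝ≥0) : ℝ≥0∞) ∂Q := by
        refine lintegral_mono_ae ?_
        filter_upwards [hJ] with x hx
        exact (hσ _ (hTS J x)).2.2.2.trans (by exact_mod_cast hx.1)
    _ = ∫⁻ x, g x ∂Q + δ := by
        simp only [ENNReal.coe_add]
        rw [lintegral_add_right _ measurable_const]
        simp

/-- The pairs of marginals of probability measures of bounded cost form a closed set. -/
lemma exists_marginals_of_mem_closure {E G : Type*} [PseudoMetricSpace E] [T2Space E]
    [CompleteSpace E] [SecondCountableTopology E] [MeasurableSpace E] [BorelSpace E]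
    [MetricSpace G] [SecondCountableTopology G] [MeasurableSpace G] [BorelSpace G]
    {p₁ p₂ : G → E} (hp₁ : Continuous p₁) (hp₂ : Continuous p₂)
    (hp : IsClosedEmbedding fun y => (p₁ y, p₂ y)) {c : G → ℝ≥0} (hc : Continuous c) {C : ℝ≥0∞}
    {m₁ m₂ : ProbabilityMeasure E}
    (hm : (m₁, m₂) ∈ closure ((fun ρ : ProbabilityMeasure G =>
      (ρ.map hp₁.measurable.aemeasurable, ρ.map hp₂.measurable.aemeasurable)) ''
        {ρ | ∫⁻ y, c y ∂(ρ : Measure G) ≤ C})) :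
    ∃ ρ : ProbabilityMeasure G, ρ.map hp₁.measurable.aemeasurable = m₁ ∧
      ρ.map hp₂.measurable.aemeasurable = m₂ ∧ ∫⁻ y, c y ∂(ρ : Measure G) ≤ C := by
  obtain ⟨u, hu, hlim⟩ := mem_closure_iff_seq_limit.1 hm
  choose ρ hρC hρu using hu
  obtain rfl : (fun n => (_, _)) = u := funext hρu
  have h₁ := (continuous_fst.tendsto _).comp hlim
  have h₂ := (continuous_snd.tendsto _).comp hlim
  have tight {p : G → E} (hp : Continuous p) {m : ProbabilityMeasure E}
      (h : Tendsto (fun n => (ρ n).map hp.measurable.aemeasurable) atTop (𝓝 m)) :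
      IsTightMeasureSet (range fun n => (ρ n : Measure G).map p) := by
    have := isTightMeasureSet_of_isCompact_closure
      (h.isCompact_insert_range.isClosed.closure_eq.symm ▸ h.isCompact_insert_range)
    refine this.subset ?_
    rintro _ ⟨n, rfl⟩
    exact ⟨_, mem_insert_of_mem _ ⟨n, rfl⟩, rfl⟩
  have htight : IsTightMeasureSet (range fun n => (ρ n : Measure G)) := by
    have hpair : IsTightMeasureSet
        (range fun n => (ρ n : Measure G).map fun y => (p₁ y, p₂ y)) := by
      refine .prodMk ?_ ?_
      · refine (tight hp₁ h₁).subset ?_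
        rintro _ ⟨_, ⟨n, rfl⟩, rfl⟩
        exact ⟨n, (Measure.fst_map_prodMk hp₂.measurable).symm⟩
      · refine (tight hp₂ h₂).subset ?_
        rintro _ ⟨_, ⟨n, rfl⟩, rfl⟩
        exact ⟨n, (Measure.snd_map_prodMk hp₁.measurable).symm⟩
    rw [isTightMeasureSet_iff_exists_isCompact_measure_compl_le] at hpair ⊢
    intro ε hε
    obtain ⟨K, hK, hKε⟩ := hpair ε hε
    refine ⟨_, hp.isCompact_preimage hK, ?_⟩
    rintro _ ⟨n, rfl⟩
    refine le_trans ?_ (hKε _ ⟨n, rfl⟩)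
    rw [Measure.map_apply hp.continuous.measurable hK.measurableSet.compl, preimage_compl]
  have hcompact : IsCompact (closure (range ρ)) := by
    refine isCompact_closure_of_isTightMeasureSet (htight.subset ?_)
    rintro _ ⟨_, ⟨n, rfl⟩, rfl⟩
    exact ⟨n, rfl⟩
  obtain ⟨ρ₀, -, φ, hφ, hρ₀⟩ :=
    hcompact.tendsto_subseq fun n => subset_closure (mem_range_self n)
  refine ⟨ρ₀, ?_, ?_, ?_⟩
  · exact tendsto_nhds_unique (((ProbabilityMeasure.continuous_map hp₁).tendsto _).comp hρ₀)
      (h₁.comp hφ.tendsto_atTop)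
  · exact tendsto_nhds_unique (((ProbabilityMeasure.continuous_map hp₂).tendsto _).comp hρ₀)
      (h₂.comp hφ.tendsto_atTop)
  · have := lintegral_le_liminf_lintegral_of_forall_isOpen_measure_le_liminf_measure
      (f := fun y => (c y : ℝ)) (by fun_prop) (fun y => (c y).2)
      fun U hU => ProbabilityMeasure.le_liminf_measure_open_of_tendsto hρ₀ hU
    simp only [ENNReal.ofReal_coe_nnreal] at this
    exact this.trans (liminf_le_of_frequently_le' (.of_forall fun n => hρC (φ n)))

/-- The points where `f` is within `ε` of a measurable minorant with the same finite lower integral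
have full outer measure. -/
lemma measure_eq_zero_of_disjoint_lt_add {X : Type*} [MeasurableSpace X] {Q : Measure X}
    {f g : X → ℝ≥0∞} (hg : Measurable g) (hgf : g ≤ f) (heq : ∫⁻ x, f x ∂Q = ∫⁻ x, g x ∂Q)
    (hfin : ∫⁻ x, f x ∂Q ≠ ∞) {ε : ℝ≥0∞} (hε : ε ≠ 0) {A : Set X} (hA : MeasurableSet A)
    (hdisj : Disjoint A {x | f x < g x + ε}) : Q A = 0 := by
  have hle : ∫⁻ x, g x + A.indicator (fun _ => ε) x ∂Q ≤ ∫⁻ x, f x ∂Q := by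
    refine lintegral_mono fun x => ?_
    by_cases hx : x ∈ A
    · simpa [hx] using Set.disjoint_left.1 hdisj hx
    · simpa [hx] using hgf x
  rw [lintegral_add_left hg, lintegral_indicator_const hA, ← heq] at hle
  have h0 : ε * Q A = 0 := by
    by_contra h
    exact (ENNReal.lt_add_right hfin h).not_ge hle
  exact (mul_eq_zero.1 h0).resolve_left hε

/-- CWD ≥ RWD3. -/
theorem cwd_ge_rwd3 (nn mm : ℕ) (Qx : Measure (Vec nn)) [IsProbabilityMeasure Qx]
    (κ κ' : Kernel (Vec nn) (Vec mm)) [IsMarkovKernel κ] [IsMarkovKernel κ'] :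
    CWD Qx κ κ' ≥ RWD3 Qx κ κ' := by
  by_cases hfin : CWD Qx κ κ' = ∞
  · simp [hfin]
  set W : Vec nn → ℝ≥0∞ := fun x => WassersteinSq sqDist (κ x) (κ' x) with hW
  obtain ⟨g₀, hg₀, hg₀W, hg₀eq⟩ := exists_measurable_le_lintegral_eq Qx W
  have hg₀fin : ∀ᵐ x ∂Qx, g₀ x < ∞ := ae_lt_top hg₀ (hg₀eq ▸ hfin)
  let g (x : Vec nn) : ℝ≥0 := (g₀ x).toNNReal
  have hg : Measurable g := hg₀.ennreal_toNNReal
  have hgW : (fun x => (g x : ℝ≥0∞)) ≤ W := fun x => ENNReal.coe_toNNReal_le_self.trans (hg₀W x)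
  have hgeq : ∫⁻ x, W x ∂Qx = ∫⁻ x, g x ∂Qx := by
    rw [hg₀eq]
    refine lintegral_congr_ae ?_
    filter_upwards [hg₀fin] with x hx
    exact (ENNReal.coe_toNNReal hx.ne).symm
  refine ENNReal.le_of_forall_pos_le_add fun ε hε _ => ?_
  have hε2 : 0 < ε / 2 := half_pos hε
  set S : Set (Vec nn) := {x | W x < g x + (ε / 2 : ℝ≥0)}
  have hS : ∀ A, MeasurableSet A → Disjoint A S → Qx A = 0 := fun A hA hAS =>
    measure_eq_zero_of_disjoint_lt_add hg.coe_nnreal_ennreal hgW hgeq hfin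
      (by exact_mod_cast hε2.ne') hA hAS
  have hSne : S.Nonempty := by
    by_contra h
    rw [not_nonempty_iff_eq_empty] at h
    simpa using hS univ .univ (by simp [h])
  let M (η : Kernel (Vec nn) (Vec mm)) (x : Vec nn) : Measure (Vec mm × Vec nn) :=
    (η x).prod (Measure.dirac x)
  have hM (η : Kernel (Vec nn) (Vec mm)) [IsMarkovKernel η] : Measurable (M η) := by
    have : M η = η ×ₖ Kernel.id := by
      ext1 x
      rw [Kernel.prod_apply, Kernel.id_apply]
    rw [this]
    exact Kernel.measurable _
  have hMp (η : Kernel (Vec nn) (Vec mm)) [IsMarkovKernel η] (x) : IsProbabilityMeasure (M η x) :=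
    inferInstanceAs (IsProbabilityMeasure ((η x).prod (Measure.dirac x)))
  let p₁ (p : Vec mm × Vec mm × Vec nn) : Vec mm × Vec nn := (p.1, p.2.2)
  let p₂ (p : Vec mm × Vec mm × Vec nn) : Vec mm × Vec nn := (p.2.1, p.2.2)
  have hp₁ : Continuous p₁ := by fun_prop
  have hp₂ : Continuous p₂ := by fun_prop
  have hp : IsClosedEmbedding fun y => (p₁ y, p₂ y) :=
    Function.LeftInverse.isClosedEmbedding (f := fun q => (q.1.1, q.2.1, q.1.2))
      (fun _ => rfl) (by fun_prop) (by fun_prop)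
  let c (p : Vec mm × Vec mm × Vec nn) : ℝ≥0 := ‖p.1 - p.2.1‖₊ ^ 2
  have hc : Continuous c := by fun_prop
  have hsq (p) : sqDist p.1 p.2.1 = (c p : ℝ≥0∞) := by simp [sqDist, c]
  have hσ : ∀ x ∈ S, ∃ σ : Measure (Vec mm × Vec mm × Vec nn), IsProbabilityMeasure σ ∧
      σ.map p₁ = M κ x ∧ σ.map p₂ = M κ' x ∧ ∫⁻ y, c y ∂σ ≤ ((g x + ε / 2 : ℝ≥0) : ℝ≥0∞) := by
    intro x hx
    simp only [S, mem_ofPred_eq, hW, WassersteinSq, iInf_lt_iff] at hx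
    obtain ⟨π, ⟨hπ, hπ₁, hπ₂⟩, hcost⟩ := hx
    have hι : Measurable fun q : Vec mm × Vec mm => (q.1, q.2, x) := by fun_prop
    refine ⟨π.map fun q => (q.1, q.2, x), Measure.isProbabilityMeasure_map hι.aemeasurable,
      ?_, ?_, ?_⟩
    · rw [Measure.map_map hp₁.measurable hι]
      simp only [M, Measure.prod_dirac, ← hπ₁]
      rw [Measure.map_map (by fun_prop) (by fun_prop)]
      rfl
    · rw [Measure.map_map hp₂.measurable hι]
      simp only [M, Measure.prod_dirac, ← hπ₂]
      rw [Measure.map_map (by fun_prop) (by fun_prop)]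
      rfl
    · rw [lintegral_map hc.measurable.coe_nnreal_ennreal hι, ENNReal.coe_add]
      simp only [← hsq]
      exact hcost.le
  choose! σ hσ using hσ
  let m (η : Kernel (Vec nn) (Vec mm)) [IsMarkovKernel η] : ProbabilityMeasure (Vec mm × Vec nn) :=
    ⟨jointYX Qx η, isProbabilityMeasure_bind' (hM η) (hMp η)⟩
  obtain ⟨ρ, hρ₁, hρ₂, hρ⟩ := exists_marginals_of_mem_closure hp₁ hp₂ hp hc
    (mem_closure_marginals_of_forall_mem hSne hS hp₁.measurable hp₂.measurable (hM κ) (hM κ')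
      hc.measurable (hg.add_const (ε / 2)) hσ (m₁ := m κ) (m₂ := m κ') rfl rfl hε2)
  have hρ₁' : (ρ : Measure (Vec mm × Vec mm × Vec nn)).map p₁ = jointYX Qx κ :=
    congrArg Subtype.val hρ₁
  have hρ₂' : (ρ : Measure (Vec mm × Vec mm × Vec nn)).map p₂ = jointYX Qx κ' :=
    congrArg Subtype.val hρ₂
  have hRWD : RWD3 Qx κ κ' ≤
      ∫⁻ p, sqDist p.1 p.2.1 ∂(ρ : Measure (Vec mm × Vec mm × Vec nn)) :=
    iInf₂_le _ ⟨inferInstance, hρ₁', hρ₂'⟩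
  rw [lintegral_congr hsq] at hRWD
  refine (hRWD.trans hρ).trans_eq ?_
  simp only [ENNReal.coe_add]
  rw [lintegral_add_right _ measurable_const, lintegral_const, measure_univ, mul_one, add_assoc,
    ← ENNReal.coe_add, add_halves, ← hgeq]
  rfl
end
end

section
/- With MWD, RWD, CWD as defined from a probability measure Q_x on X = ℝⁿ and Markov kernels κ, κ̂ from X to Y = ℝᵐ: if CWD = 0 then RWD = 0 and MWD = 0. -/
open MeasureTheory ProbabilityTheory
open scoped ENNReal

noncomputable section

lemma sq_lintegral_le_lintegral_sq {Ω : Type*} [MeasurableSpace Ω] (π : Measure Ω)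
    [IsProbabilityMeasure π] {f : Ω → ℝ≥0∞} (hf : AEMeasurable f π) :
    (∫⁻ ω, f ω ∂π) ^ 2 ≤ ∫⁻ ω, f ω ^ 2 ∂π := by
  have h := ENNReal.lintegral_mul_le_Lp_mul_Lq π Real.HolderConjugate.two_two hf
    (aemeasurable_const (b := (1 : ℝ≥0∞)))
  simp only [Pi.mul_apply, mul_one, lintegral_const, measure_univ, ENNReal.rpow_ofNat,
    one_pow, ENNReal.one_rpow] at h
  calc (∫⁻ ω, f ω ∂π) ^ 2 ≤ ((∫⁻ ω, f ω ^ 2 ∂π) ^ (1 / 2 : ℝ)) ^ 2 := by gcongr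
    _ = ∫⁻ ω, f ω ^ 2 ∂π := by
      rw [← ENNReal.rpow_natCast, ← ENNReal.rpow_mul]; norm_num

lemma sqDist_comm {E : Type*} [NormedAddCommGroup E] (u v : E) : sqDist u v = sqDist v u := by
  simp only [sqDist, ← nnnorm_neg (u - v), neg_sub]

lemma sqDist_self {E : Type*} [NormedAddCommGroup E] (u : E) : sqDist u u = 0 := by
  simp [sqDist]

lemma WassersteinSq_comm {E : Type*} [MeasurableSpace E] {c : E → E → ℝ≥0∞}
    (hc : ∀ u v, c u v = c v u) (μ ν : Measure E) :
    WassersteinSq c μ ν = WassersteinSq c ν μ := by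
  have key (μ ν : Measure E) : WassersteinSq c μ ν ≤ WassersteinSq c ν μ := by
    refine le_iInf₂ fun π ⟨h1, h2, h3⟩ ↦ ?_
    have hπ : IsCoupling μ ν (π.map Prod.swap) := ⟨?_, ?_, ?_⟩
    · exact (iInf₂_le _ hπ).trans ((lintegral_map_le _ _).trans
        (lintegral_mono fun p ↦ (hc p.2 p.1).le))
    · exact Measure.isProbabilityMeasure_map measurable_swap.aemeasurable
    · rwa [Measure.map_map measurable_fst measurable_swap]
    · rwa [Measure.map_map measurable_snd measurable_swap]
  exact (key μ ν).antisymm (key ν μ)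

lemma WassersteinSq_self {E : Type*} [MeasurableSpace E] {c : E → E → ℝ≥0∞}
    (hc : ∀ u, c u u = 0) (μ : Measure E) [IsProbabilityMeasure μ] :
    WassersteinSq c μ μ = 0 := by
  have hm : Measurable fun u : E ↦ (u, u) := by fun_prop
  have hπ : IsCoupling μ μ (μ.map fun u ↦ (u, u)) := ⟨?_, ?_, ?_⟩
  · exact le_antisymm ((iInf₂_le _ hπ).trans ((lintegral_map_le _ _).trans (by simp [hc]))) zero_le
  · exact Measure.isProbabilityMeasure_map hm.aemeasurable
  · rw [Measure.map_map measurable_fst hm]; exact Measure.map_id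
  · rw [Measure.map_map measurable_snd hm]; exact Measure.map_id

/-- Kantorovich-type lower bound of the squared Wasserstein cost by Lipschitz test functions. -/
lemma sq_lintegral_sub_le_WassersteinSq {E : Type*} [NormedAddCommGroup E] [MeasurableSpace E]
    [BorelSpace E] [SecondCountableTopology E] {K : NNReal} {f : E → NNReal}
    (hf : LipschitzWith K f) (hK : K ≠ 0) (μ ν : Measure E) :
    (∫⁻ u, f u ∂μ - ∫⁻ u, f u ∂ν) ^ 2 ≤ (K : ℝ≥0∞) ^ 2 * WassersteinSq sqDist μ ν := by
  have hfm : Measurable fun u ↦ (f u : ℝ≥0∞) := hf.continuous.measurable.coe_nnreal_ennreal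
  rw [WassersteinSq, iInf_subtype', ENNReal.mul_iInf_of_ne (by simpa using hK) (by finiteness)]
  refine le_iInf fun ⟨π, h1, h2, h3⟩ ↦ ?_
  have hd : Measurable fun p : E × E ↦ edist p.1 p.2 := by fun_prop
  have hle : ∫⁻ u, f u ∂μ - ∫⁻ u, f u ∂ν ≤ K * ∫⁻ p, edist p.1 p.2 ∂π := by
    rw [tsub_le_iff_left, ← h2, ← h3, lintegral_map hfm measurable_fst,
      lintegral_map hfm measurable_snd, ← lintegral_const_mul _ hd,
      ← lintegral_add_right _ (hd.const_mul _)]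
    refine lintegral_mono fun p ↦ ?_
    calc (f p.1 : ℝ≥0∞) ≤ f p.2 + edist (f p.1) (f p.2) := by
          rw [edist_nndist, ← ENNReal.coe_add, ENNReal.coe_le_coe, ← tsub_le_iff_left,
            NNReal.nndist_eq]
          exact le_max_left _ _
      _ ≤ f p.2 + K * edist p.1 p.2 := by gcongr; exact hf p.1 p.2
  calc _ ≤ (K * ∫⁻ p, edist p.1 p.2 ∂π) ^ 2 := by gcongr
    _ = K ^ 2 * (∫⁻ p, edist p.1 p.2 ∂π) ^ 2 := mul_pow _ _ _
    _ ≤ K ^ 2 * ∫⁻ p, edist p.1 p.2 ^ 2 ∂π := by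
      gcongr; exact sq_lintegral_le_lintegral_sq π hd.aemeasurable
    _ = _ := by simp [sqDist, edist_eq_enorm_sub, enorm_eq_nnnorm]

/-- Kernels that integrate Lipschitz functions identically almost everywhere agree almost
everywhere. -/
lemma Kernel.ae_eq_of_forall_lipschitz {α E : Type*} [MeasurableSpace α] {μ : Measure α}
    [IsFiniteMeasure μ] [PseudoEMetricSpace E] [mE : MeasurableSpace E] [BorelSpace E]
    [MeasurableSpace.CountablyGenerated E] {κ η : Kernel α E} [IsMarkovKernel κ]
    [IsMarkovKernel η]
    (h : ∀ (K : NNReal) (f : E → NNReal), K ≠ 0 → LipschitzWith K f →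
      ∀ᵐ x ∂μ, ∫⁻ u, f u ∂κ x = ∫⁻ u, f u ∂η x) : κ =ᵐ[μ] η := by
  have hclosed (F : Set E) (hF : IsClosed F) : ∀ᵐ x ∂μ, κ x F = η x F := by
    have hδ (n : ℕ) : (0 : ℝ) < 1 / (n + 1) := Nat.one_div_pos_of_nat
    have hlim := tendsto_one_div_add_atTop_nhds_zero_nat (𝕜 := ℝ)
    filter_upwards [ae_all_iff.2 fun n ↦ h _ _ (by simpa using hδ n)
      (lipschitzWith_thickenedIndicator (hδ n) F)]
      with x hx
    refine tendsto_nhds_unique (tendsto_lintegral_thickenedIndicator_of_isClosed (κ x) hF hδ hlim)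
      ?_
    simpa only [hx] using tendsto_lintegral_thickenedIndicator_of_isClosed (η x) hF hδ hlim
  have hmeas (s : Set E) (hs : MeasurableSet s) : ∀ᵐ x ∂μ, κ x s = η x s := by
    have hgen : mE = .generateFrom {s | IsClosed s} :=
      BorelSpace.measurable_eq.trans borel_eq_generateFrom_isClosed
    induction s, hs using MeasurableSpace.induction_on_inter hgen isPiSystem_isClosed with
    | empty => simp
    | basic F hF => exact hclosed F hF
    | compl s hs ih =>
      filter_upwards [ih] with x hx
      rw [prob_compl_eq_one_sub hs, prob_compl_eq_one_sub hs, hx]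
    | iUnion s hd hs ih =>
      filter_upwards [ae_all_iff.2 ih] with x hx
      rw [measure_iUnion hd hs, measure_iUnion hd hs]
      simp only [hx]
  refine Kernel.ae_eq_of_compProd_eq (Measure.ext_prod fun {s t} hs ht ↦ ?_)
  rw [Measure.compProd_apply_prod hs ht, Measure.compProd_apply_prod hs ht]
  exact lintegral_congr_ae (ae_restrict_of_ae (hmeas t ht))

lemma ae_eq_of_CWD_eq_zero {nn mm : ℕ} {Qx : Measure (Vec nn)} [IsFiniteMeasure Qx]
    {κ κ' : Kernel (Vec nn) (Vec mm)} [IsMarkovKernel κ] [IsMarkovKernel κ']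
    (h : CWD Qx κ κ' = 0) : κ =ᵐ[Qx] κ' := by
  have key (η η' : Kernel (Vec nn) (Vec mm)) (h : CWD Qx η η' = 0) (K : NNReal)
      (f : Vec mm → NNReal) (hK : K ≠ 0) (hf : LipschitzWith K f) :
      ∀ᵐ x ∂Qx, ∫⁻ u, f u ∂η x ≤ ∫⁻ u, f u ∂η' x := by
    have hfm : Measurable fun u ↦ (f u : ℝ≥0∞) := hf.continuous.measurable.coe_nnreal_ennreal
    have h0 : ∫⁻ x, (∫⁻ u, f u ∂η x - ∫⁻ u, f u ∂η' x) ^ 2 ∂Qx = 0 := by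
      refine le_antisymm ((lintegral_mono fun x ↦
        sq_lintegral_sub_le_WassersteinSq hf hK (η x) (η' x)).trans ?_) zero_le
      rw [lintegral_const_mul' _ _ (by finiteness)]
      rw [show ∫⁻ x, WassersteinSq sqDist (η x) (η' x) ∂Qx = 0 from h, mul_zero]
    rw [lintegral_eq_zero_iff (show Measurable fun x ↦ (∫⁻ u, f u ∂η x - ∫⁻ u, f u ∂η' x) ^ 2
      from (hfm.lintegral_kernel.sub hfm.lintegral_kernel).pow_const 2)] at h0
    filter_upwards [h0] with x hx
    simpa [tsub_eq_zero_iff_le] using hx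
  have h' : CWD Qx κ' κ = 0 := by
    rw [← h]
    exact lintegral_congr fun x ↦ WassersteinSq_comm sqDist_comm _ _
  refine Kernel.ae_eq_of_forall_lipschitz fun K f hK hf ↦ ?_
  filter_upwards [key κ κ' h K f hK hf, key κ' κ h' K f hK hf] with x h₁ h₂ using h₁.antisymm h₂

lemma jointYX_congr {nn mm : ℕ} {Qx : Measure (Vec nn)} {κ κ' : Kernel (Vec nn) (Vec mm)}
    (h : κ =ᵐ[Qx] κ') : jointYX Qx κ = jointYX Qx κ' := by
  simp only [jointYX, Measure.bind]
  congr 1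
  refine Measure.map_congr ?_
  filter_upwards [h] with x hx
  rw [hx]

instance isProbabilityMeasure_jointYX {nn mm : ℕ} (Qx : Measure (Vec nn)) [IsProbabilityMeasure Qx]
    (κ : Kernel (Vec nn) (Vec mm)) [IsMarkovKernel κ] : IsProbabilityMeasure (jointYX Qx κ) := by
  have : jointYX Qx κ = Qx.bind (κ ×ₖ Kernel.id) := by
    simp only [jointYX]
    congr 1
    ext1 x
    rw [Kernel.prod_apply, Kernel.id_apply]
  rw [this]
  infer_instance

/-- If CWD = 0 then RWD = 0 and MWD = 0. -/
theorem cwd_eq_zero_imp (nn mm : ℕ) (Qx : Measure (Vec nn)) [IsProbabilityMeasure Qx]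
    (κ κ' : Kernel (Vec nn) (Vec mm)) [IsMarkovKernel κ] [IsMarkovKernel κ']
    (h : CWD Qx κ κ' = 0) :
    RWD Qx κ κ' = 0 ∧ MWD Qx κ κ' = 0 := by
  have hj := jointYX_congr (ae_eq_of_CWD_eq_zero h)
  have : IsProbabilityMeasure ((jointYX Qx κ').map Prod.fst) :=
    Measure.isProbabilityMeasure_map measurable_fst.aemeasurable
  rw [RWD, MWD, hj]
  exact ⟨WassersteinSq_self (fun u ↦ by simp [sqDist_self]) _, WassersteinSq_self sqDist_self _⟩
end
end
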